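/- arXiv:1203.0497 — 7 statements merged into one kernel-verified Lean document; each statement's English description precedes it below -/
import Mathlib

section
/- Let a be an exact Courant algebra over a Lie algebra g, with bracket ⁅·,·⁆ and projection π, and let h = ker π. For x ∈ g and λ ∈ h set x · λ := ⁅α,λ⁆, where α ∈ a is any element with π(α) = x (this is well defined and lies in h). Then the map (x,λ) ↦ x · λ is bilinear and satisfies [x,y] · λ = x · (y · λ) − y · (x · λ) for all x,y ∈ g and λ ∈ h; that is, it makes h into a g-module. -/
/-- If brackets of elements of `ker π` vanish, then the left action of `α` on `ker π` depends only
on `π α`. -/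
theorem bracket_eq_of_projection_eq {k g a : Type*} [CommRing k] [AddCommGroup g] [Module k g]
    [AddCommGroup a] [Module k a] (br : a →ₗ[k] a →ₗ[k] a) (π : a →ₗ[k] g)
    (hker : ∀ l l' : a, π l = 0 → π l' = 0 → br l l' = 0)
    {α β l : a} (h : π α = π β) (hl : π l = 0) : br α l = br β l := by
  have := hker (α - β) l (by rw [map_sub, h, sub_self]) hl
  rwa [map_sub, LinearMap.sub_apply, sub_eq_zero] at this

/-- Let `a` be an exact Courant algebra over a Lie algebra `g` with bracket `br`,
projection `π` and `h = ker π`. Given any section `s : g → a` of `π`, the map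
`(x, λ) ↦ x · λ := br (s x) λ` (which is independent of the chosen section, lands in `h`,
and is defined for `λ ∈ h`) is bilinear and satisfies
`[x,y] · λ = x · (y · λ) − y · (x · λ)`; that is, it makes `h` into a `g`-module. -/
theorem exact_courant_algebra_kernel_is_module
    (k : Type*) [Field k] (g : Type*) [LieRing g] [LieAlgebra k g]
    (a : Type*) [AddCommGroup a] [Module k a]
    (br : a →ₗ[k] a →ₗ[k] a) (π : a →ₗ[k] g)
    -- (c1) the Leibniz identity
    (hLeib : ∀ α₁ α₂ α₃ : a, br α₁ (br α₂ α₃) = br (br α₁ α₂) α₃ + br α₂ (br α₁ α₃))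
    -- (c2) π preserves brackets
    (hπ : ∀ α₁ α₂ : a, π (br α₁ α₂) = ⁅π α₁, π α₂⁆)
    -- exactness
    (hsurj : Function.Surjective π)
    (hker : ∀ l l' : a, π l = 0 → π l' = 0 → br l l' = 0)
    -- a section of π, used to define x · λ := ⁅s x, λ⁆
    (s : g → a) (hs : ∀ x : g, π (s x) = x) :
    -- the action lands in h = ker π
    (∀ (x : g) (l : a), π l = 0 → π (br (s x) l) = 0) ∧
    -- additivity and homogeneity in the g-variable
    (∀ (x y : g) (l : a), π l = 0 → br (s (x + y)) l = br (s x) l + br (s y) l) ∧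
    (∀ (c : k) (x : g) (l : a), π l = 0 → br (s (c • x)) l = c • br (s x) l) ∧
    -- additivity and homogeneity in the h-variable
    (∀ (x : g) (l l' : a), br (s x) (l + l') = br (s x) l + br (s x) l') ∧
    (∀ (x : g) (c : k) (l : a), br (s x) (c • l) = c • br (s x) l) ∧
    -- the module identity [x,y] · λ = x · (y · λ) − y · (x · λ)
    (∀ (x y : g) (l : a), π l = 0 →
      br (s ⁅x, y⁆) l = br (s x) (br (s y) l) - br (s y) (br (s x) l)) := by
  refine ⟨fun x l hl => by rw [hπ, hl, lie_zero], fun x y l hl => ?_, fun c x l hl => ?_,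
    fun x => map_add _, fun x => map_smul _, fun x y l hl => ?_⟩
  · rw [← LinearMap.add_apply, ← map_add]
    exact bracket_eq_of_projection_eq br π hker (by simp [hs]) hl
  · rw [← LinearMap.smul_apply, ← map_smul]
    exact bracket_eq_of_projection_eq br π hker (by simp [hs]) hl
  · rw [hLeib, add_sub_cancel_right]
    exact bracket_eq_of_projection_eq br π hker (by simp [hs, hπ]) hl
end

section
/- Let W be a finite-dimensional real vector space and let B be the standard pairing on V = W × W*. A subspace P ⊆ V with dim P = dim W satisfies B(p,p) > 0 for all nonzero p ∈ P if and only if P is the graph {(X, A(X)) : X ∈ W} of a linear map A : W → W* whose symmetric part g(X,Y) := ½(A(X)(Y) + A(Y)(X)) is a positive-definite bilinear form on W. In that case A(X)(Y) = g(X,Y) + b(X,Y) where b(X,Y) := ½(A(X)(Y) − A(Y)(X)) is an alternating bilinear form. -/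
/-- The standard pairing `B((X,ξ),(Y,η)) = ½(η(X) + ξ(Y))` on `W × W*`. -/
noncomputable def stdPairing (W : Type*) [AddCommGroup W] [Module ℝ W] :
    LinearMap.BilinForm ℝ (W × Module.Dual ℝ W) :=
  LinearMap.mk₂ ℝ (fun p q => (q.2 p.1 + p.2 q.1) / 2)
    (by intro m m' n; simp; ring)
    (by intro c m n; simp; ring)
    (by intro m n n'; simp; ring)
    (by intro c m n; simp; ring)

theorem stdPairing_self {W : Type*} [AddCommGroup W] [Module ℝ W]
    (p : W × Module.Dual ℝ W) : stdPairing W p p = p.2 p.1 := by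
  simp [stdPairing]

/-- A positive definite subspace meets `0 × W*` trivially, so if it has the dimension of `W`
it projects isomorphically onto `W`. -/
theorem exists_eq_graph_of_stdPairing_pos {W : Type*} [AddCommGroup W] [Module ℝ W]
    [FiniteDimensional ℝ W] {P : Submodule ℝ (W × Module.Dual ℝ W)}
    (hdim : Module.finrank ℝ P = Module.finrank ℝ W)
    (hP : ∀ p ∈ P, p ≠ 0 → 0 < stdPairing W p p) :
    ∃ A : W →ₗ[ℝ] Module.Dual ℝ W, P = A.graph := by
  let π : P →ₗ[ℝ] W := LinearMap.fst ℝ W (Module.Dual ℝ W) ∘ₗ P.subtype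
  have hinj : Function.Injective π := by
    rw [injective_iff_map_eq_zero]
    rintro ⟨p, hp⟩ h
    by_contra hne
    have hfst : p.1 = 0 := h
    have hpos := hP p hp fun h0 => hne (Subtype.ext h0)
    simp [stdPairing_self, hfst] at hpos
  have hsurj : Function.Surjective π :=
    (LinearMap.injective_iff_surjective_of_finrank_eq_finrank (K := ℝ) (V := P) hdim).1 hinj
  exact Submodule.exists_eq_graph ⟨hinj, hsurj⟩

theorem stdPairing_pos_on_graph_iff {W : Type*} [AddCommGroup W] [Module ℝ W]
    (A : W →ₗ[ℝ] Module.Dual ℝ W) :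
    (∀ p ∈ A.graph, p ≠ 0 → 0 < stdPairing W p p) ↔ ∀ X : W, X ≠ 0 → 0 < A X X := by
  constructor
  · intro h X hX
    simpa [stdPairing_self] using
      h (X, A X) (by simp) fun h0 => hX (congrArg Prod.fst h0)
  · rintro h ⟨X, ξ⟩ hp hne
    obtain rfl : ξ = A X := by simpa using hp
    rw [stdPairing_self]
    exact h X fun hX => hne (by simp [hX])

/-- A subspace `P ⊆ W × W*` with `dim P = dim W` is positive definite for the standard
pairing iff it is the graph of a linear map `A : W → W*` whose symmetric part
`g(X,Y) = ½(A(X)(Y) + A(Y)(X))` is positive definite; in that case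
`A(X)(Y) = g(X,Y) + b(X,Y)` with `b(X,Y) = ½(A(X)(Y) − A(Y)(X))` alternating. -/
theorem positive_definite_subspace_iff_graph_of_metric_plus_two_form
    (W : Type*) [AddCommGroup W] [Module ℝ W] [FiniteDimensional ℝ W]
    (P : Submodule ℝ (W × Module.Dual ℝ W))
    (hdim : Module.finrank ℝ P = Module.finrank ℝ W) :
    ((∀ p ∈ P, p ≠ 0 → 0 < stdPairing W p p) ↔
      ∃ A : W →ₗ[ℝ] Module.Dual ℝ W, P = A.graph ∧
        ∀ X : W, X ≠ 0 → 0 < (A X X + A X X) / 2) ∧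
    ((∀ p ∈ P, p ≠ 0 → 0 < stdPairing W p p) →
      ∀ A : W →ₗ[ℝ] Module.Dual ℝ W, P = A.graph → ∀ X Y : W,
        A X Y = (A X Y + A Y X) / 2 + (A X Y - A Y X) / 2 ∧
        (A X Y - A Y X) / 2 = -((A Y X - A X Y) / 2) ∧
        (A X X - A X X) / 2 = 0) := by
  refine ⟨⟨fun hP => ?_, ?_⟩, fun _ A _ X Y => ⟨by ring, by ring, by ring⟩⟩
  · obtain ⟨A, rfl⟩ := exists_eq_graph_of_stdPairing_pos hdim hP
    exact ⟨A, rfl, by simpa only [add_self_div_two] using (stdPairing_pos_on_graph_iff A).1 hP⟩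
  · rintro ⟨A, rfl, hA⟩
    exact (stdPairing_pos_on_graph_iff A).2 (by simpa only [add_self_div_two] using hA)
end

section
/- Let V be a finite-dimensional real vector space, B a nondegenerate symmetric bilinear form on V, G a generalized metric on (V,B), and K ⊆ V an isotropic subspace. Then K ⊆ K⊥ and K⊥ = K ⊕ (K⊥ ∩ G(K⊥)); that is, K^G := K⊥ ∩ G(K⊥) is a linear complement of K inside K⊥ (it is the orthogonal complement of K in K⊥ with respect to the inner product B(G·,·)). -/
/-- The orthogonal complement `K⊥ = {v : B(v,k) = 0 ∀ k ∈ K}` of a subspace with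
respect to a bilinear form `B`. -/
def orthComp {V : Type*} [AddCommGroup V] [Module ℝ V]
    (B : LinearMap.BilinForm ℝ V) (K : Submodule ℝ V) : Submodule ℝ V where
  carrier := {v | ∀ k ∈ K, B v k = 0}
  add_mem' := by intro a b ha hb k hk; simp [ha k hk, hb k hk]
  zero_mem' := by intro k hk; simp
  smul_mem' := by intro c a ha k hk; simp [ha k hk]

theorem mem_orthComp {V : Type*} [AddCommGroup V] [Module ℝ V]
    {B : LinearMap.BilinForm ℝ V} {K : Submodule ℝ V} {v : V} :
    v ∈ orthComp B K ↔ ∀ k ∈ K, B v k = 0 :=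
  Iff.rfl

theorem orthComp_eq_orthogonal {V : Type*} [AddCommGroup V] [Module ℝ V]
    {B : LinearMap.BilinForm ℝ V} (hsymm : ∀ x y : V, B x y = B y x) (K : Submodule ℝ V) :
    orthComp B K = B.orthogonal K := by
  ext v
  simp only [mem_orthComp, LinearMap.BilinForm.mem_orthogonal_iff, hsymm v]

theorem isCompl_orthComp_of_pos {V : Type*} [AddCommGroup V] [Module ℝ V]
    [FiniteDimensional ℝ V] {B : LinearMap.BilinForm ℝ V}
    (hsymm : ∀ x y : V, B x y = B y x) (hpos : ∀ x : V, x ≠ 0 → 0 < B x x)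
    (K : Submodule ℝ V) : IsCompl K (orthComp B K) := by
  have hrefl : B.IsRefl := fun x y h => by rw [hsymm, h]
  rw [orthComp_eq_orthogonal hsymm, LinearMap.BilinForm.isCompl_orthogonal_iff_disjoint hrefl,
    ← orthComp_eq_orthogonal hsymm, Submodule.disjoint_def]
  intro x hx hx'
  by_contra hne
  exact (hpos x hne).ne' (hx' x hx)

/-- An orthogonal self-adjoint endomorphism of a nondegenerate form is an involution. -/
theorem apply_apply_of_orthogonal_of_selfAdjoint {V : Type*} [AddCommGroup V] [Module ℝ V]
    {B : LinearMap.BilinForm ℝ V} (hnd : ∀ x : V, (∀ y : V, B x y = 0) → x = 0)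
    {G : V →ₗ[ℝ] V} (horth : ∀ x y : V, B (G x) (G y) = B x y)
    (hsa : ∀ x y : V, B (G x) y = B x (G y)) (x : V) : G (G x) = x :=
  sub_eq_zero.1 <| hnd _ fun y => by simp [hsa (G x), horth]

/-- The image `G(K⊥)` is the orthogonal complement of `K` with respect to `B(G·,·)`. -/
theorem map_orthComp {V : Type*} [AddCommGroup V] [Module ℝ V]
    {B : LinearMap.BilinForm ℝ V} {G : V →ₗ[ℝ] V} (hG : ∀ x, G (G x) = x)
    (K : Submodule ℝ V) : Submodule.map G (orthComp B K) = orthComp (B ∘ₗ G) K := by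
  ext v
  rw [Submodule.mem_map]
  constructor
  · rintro ⟨u, hu, rfl⟩ k hk
    simpa [hG] using hu k hk
  · exact fun hv => ⟨G v, hv, hG v⟩

/-- If `G` is a generalized metric and `K` is isotropic, then `K ⊆ K⊥` and
`K^G := K⊥ ∩ G(K⊥)` is a linear complement of `K` inside `K⊥`, i.e.
`K⊥ = K ⊕ K^G`. -/
theorem isotropic_complement_in_perp
    (V : Type*) [AddCommGroup V] [Module ℝ V] [FiniteDimensional ℝ V]
    (B : LinearMap.BilinForm ℝ V)
    (hnd : ∀ x : V, (∀ y : V, B x y = 0) → x = 0)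
    (hsymm : ∀ x y : V, B x y = B y x)
    (G : V →ₗ[ℝ] V)
    (horth : ∀ x y : V, B (G x) (G y) = B x y)
    (hsa : ∀ x y : V, B (G x) y = B x (G y))
    (hpos : ∀ x : V, x ≠ 0 → 0 < B (G x) x)
    (K : Submodule ℝ V)
    (hK : ∀ x ∈ K, ∀ y ∈ K, B x y = 0) :
    K ≤ orthComp B K ∧
    K ⊔ (orthComp B K ⊓ Submodule.map G (orthComp B K)) = orthComp B K ∧
    K ⊓ (orthComp B K ⊓ Submodule.map G (orthComp B K)) = ⊥ := by
  have hle : K ≤ orthComp B K := hK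
  have hcompl : IsCompl K (orthComp (B ∘ₗ G) K) :=
    isCompl_orthComp_of_pos (B := B ∘ₗ G)
      (fun x y => (hsa x y).trans (hsymm x (G y))) hpos K
  rw [map_orthComp (apply_apply_of_orthogonal_of_selfAdjoint hnd horth hsa)]
  refine ⟨hle, ?_, (hcompl.disjoint.mono_right inf_le_right).eq_bot⟩
  rw [inf_comm, ← sup_inf_assoc_of_le _ hle, hcompl.sup_eq_top, top_inf_eq]
end

section
/- Let V be a finite-dimensional real vector space, B a nondegenerate symmetric bilinear form on V, G a generalized metric on (V,B) with ±1-eigenspaces V₊ and V₋, and K ⊆ V an isotropic subspace. Let q : K⊥ → K⊥/K be the quotient map and B^red the induced symmetric bilinear form on K⊥/K (B^red(q x, q y) = B(x,y) for x,y ∈ K⊥). Then K⊥/K = q(V₊ ∩ K⊥) ⊕ q(V₋ ∩ K⊥), and B^red is positive definite on q(V₊ ∩ K⊥) and negative definite on q(V₋ ∩ K⊥). In particular, the generalized metric G reduces to a generalized metric on (K⊥/K, B^red) whose ±1-eigenspaces are q(V₊ ∩ K⊥) and q(V₋ ∩ K⊥). -/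
/-- If `x ↦ B (G x) x` is positive definite, every vector admits a best approximation in a
subspace `K` with respect to the form `(x, y) ↦ B (G x) y`. -/
theorem exists_mem_forall_apply_sub_eq_zero
    {V : Type*} [AddCommGroup V] [Module ℝ V] [FiniteDimensional ℝ V]
    (B : LinearMap.BilinForm ℝ V) (G : V →ₗ[ℝ] V)
    (hpos : ∀ x : V, x ≠ 0 → 0 < B (G x) x) (K : Submodule ℝ V) (x : V) :
    ∃ k ∈ K, ∀ l ∈ K, B (G (x - k)) l = 0 := by
  let f : K →ₗ[ℝ] Module.Dual ℝ K := (B.comp G LinearMap.id).domRestrict₁₂ K K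
  have hinj : Function.Injective f := by
    rw [injective_iff_map_eq_zero]
    intro k hk
    by_contra hne
    have h : B (G k) k = 0 := LinearMap.congr_fun hk k
    exact (hpos k (by simpa using hne)).ne' h
  have hsurj : Function.Surjective f :=
    (LinearMap.injective_iff_surjective_of_finrank_eq_finrank
      Subspace.dual_finrank_eq.symm).1 hinj
  obtain ⟨k, hk⟩ := hsurj ((B (G x)).domRestrict K)
  refine ⟨k, k.2, fun l hl => ?_⟩
  have h : B (G k) l = B (G x) l := LinearMap.congr_fun hk ⟨l, hl⟩
  simp [h]

/-- The largest subspace of `K⊥` stable under an involution `G` maps isomorphically onto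
`K⊥/K` when `G` is a generalized metric. -/
theorem bijective_mkQ_comp_inclusion
    {V : Type*} [AddCommGroup V] [Module ℝ V] [FiniteDimensional ℝ V]
    (B : LinearMap.BilinForm ℝ V) (G : V →ₗ[ℝ] V)
    (hpos : ∀ x : V, x ≠ 0 → 0 < B (G x) x) (K : Submodule ℝ V)
    (hK : ∀ x ∈ K, ∀ y ∈ K, B x y = 0) :
    Function.Bijective
      ((K.comap (orthComp B K).subtype).mkQ ∘ₗ
        Submodule.inclusion
          (inf_le_left : orthComp B K ⊓ (orthComp B K).comap G ≤ orthComp B K)) := by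
  constructor
  · rw [injective_iff_map_eq_zero]
    rintro ⟨w, hw, hGw⟩ h
    have hwK : w ∈ K := by
      simpa [Submodule.Quotient.mk_eq_zero] using h
    by_contra hne
    exact (hpos w fun h => hne (Subtype.ext h)).ne' (hGw w hwK)
  · intro u
    obtain ⟨x, rfl⟩ := Submodule.mkQ_surjective _ u
    obtain ⟨k, hk, h⟩ := exists_mem_forall_apply_sub_eq_zero B G hpos K x
    refine ⟨⟨x - k, Submodule.sub_mem _ x.2 (hK k hk), h⟩, ?_⟩
    exact (Submodule.Quotient.eq _).2 (by simpa using hk)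

/-- A generalized metric `G` reduces along an isotropic subspace `K`: with
`q : K⊥ → K⊥/K` the quotient map and `B^red` the induced form,
`K⊥/K = q(V₊ ∩ K⊥) ⊕ q(V₋ ∩ K⊥)`, `B^red` is positive definite on `q(V₊ ∩ K⊥)` and
negative definite on `q(V₋ ∩ K⊥)`, and there is a generalized metric on
`(K⊥/K, B^red)` with these eigenspaces. -/
theorem generalized_metric_reduction
    (V : Type*) [AddCommGroup V] [Module ℝ V] [FiniteDimensional ℝ V]
    (B : LinearMap.BilinForm ℝ V)
    (hnd : ∀ x : V, (∀ y : V, B x y = 0) → x = 0)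
    (hsymm : ∀ x y : V, B x y = B y x)
    (G : V →ₗ[ℝ] V)
    (horth : ∀ x y : V, B (G x) (G y) = B x y)
    (hsa : ∀ x y : V, B (G x) y = B x (G y))
    (hpos : ∀ x : V, x ≠ 0 → 0 < B (G x) x)
    (K : Submodule ℝ V)
    (hK : ∀ x ∈ K, ∀ y ∈ K, B x y = 0) :
    let Vp := LinearMap.ker (G - LinearMap.id)
    let Vm := LinearMap.ker (G + LinearMap.id)
    let Kp := orthComp B K
    let K' := K.comap Kp.subtype
    let q := K'.mkQ
    let Sp := Submodule.map q (Vp.comap Kp.subtype)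
    let Sm := Submodule.map q (Vm.comap Kp.subtype)
    -- B^red : the symmetric bilinear form induced by B on K⊥/K
    ∀ Bred : LinearMap.BilinForm ℝ (Kp ⧸ K'),
      (∀ x y : Kp, Bred (q x) (q y) = B (x : V) (y : V)) →
      -- K⊥/K = q(V₊ ∩ K⊥) ⊕ q(V₋ ∩ K⊥)
      (Sp ⊔ Sm = ⊤) ∧ (Sp ⊓ Sm = ⊥) ∧
      -- B^red is positive definite on q(V₊ ∩ K⊥) and negative definite on q(V₋ ∩ K⊥)
      (∀ x : Kp, (x : V) ∈ Vp → q x ≠ 0 → 0 < Bred (q x) (q x)) ∧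
      (∀ x : Kp, (x : V) ∈ Vm → q x ≠ 0 → Bred (q x) (q x) < 0) ∧
      -- G reduces to a generalized metric with eigenspaces Sp and Sm
      (∃ Gred : (Kp ⧸ K') →ₗ[ℝ] (Kp ⧸ K'),
        (∀ u v, Bred (Gred u) (Gred v) = Bred u v) ∧
        (∀ u v, Bred (Gred u) v = Bred u (Gred v)) ∧
        (∀ u, u ≠ 0 → 0 < Bred (Gred u) u) ∧
        LinearMap.ker (Gred - LinearMap.id) = Sp ∧
        LinearMap.ker (Gred + LinearMap.id) = Sm) := by
  intro Vp Vm Kp K' q Sp Sm Bred hBred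
  have hGG : ∀ x, G (G x) = x := fun x =>
    sub_eq_zero.1 (hnd _ fun y => by simp [hsa (G x) y, horth])
  have hVp : ∀ x, x ∈ Vp ↔ G x = x := fun x => by simp [Vp, sub_eq_zero]
  have hVm : ∀ x, x ∈ Vm ↔ G x = -x := fun x => by simp [Vm, add_eq_zero_iff_eq_neg]
  let W : Submodule ℝ V := Kp ⊓ Kp.comap G
  let e : W ≃ₗ[ℝ] (Kp ⧸ K') :=
    LinearEquiv.ofBijective _ (bijective_mkQ_comp_inclusion B G hpos K hK)
  have he : ∀ w : W, e w = q ⟨w, w.2.1⟩ := fun _ => rfl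
  have hBe : ∀ w w' : W, Bred (e w) (e w') = B w w' := fun w w' => hBred _ _
  have hGW : ∀ w ∈ W, G w ∈ W := fun w hw =>
    ⟨hw.2, by simpa [hGG] using hw.1⟩
  let GW : W →ₗ[ℝ] W := G.restrict hGW
  let Gred : (Kp ⧸ K') →ₗ[ℝ] (Kp ⧸ K') := e.toLinearMap ∘ₗ GW ∘ₗ e.symm.toLinearMap
  have hGred : ∀ w : W, Gred (e w) = e (GW w) := fun w => by simp [Gred]
  have hker : LinearMap.ker (Gred - LinearMap.id) = Sp := by
    ext u
    constructor
    · obtain ⟨w, rfl⟩ := e.surjective u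
      intro h
      have hw : GW w = w :=
        e.injective (by rw [← hGred]; exact sub_eq_zero.1 h)
      exact ⟨⟨w, w.2.1⟩, (hVp _).2 (congrArg Subtype.val hw), rfl⟩
    · rintro ⟨x, hx, rfl⟩
      have hGx : G x = x := (hVp _).1 hx
      let w : W := ⟨x, x.2, by simp [hGx]⟩
      have hw : GW w = w := Subtype.ext hGx
      change Gred (e w) - e w = 0
      rw [hGred, hw, sub_self]
  have hker' : LinearMap.ker (Gred + LinearMap.id) = Sm := by
    ext u
    constructor
    · obtain ⟨w, rfl⟩ := e.surjective u
      intro h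
      have hw : GW w = -w :=
        e.injective (by rw [← hGred, map_neg]; exact add_eq_zero_iff_eq_neg.1 h)
      exact ⟨⟨w, w.2.1⟩, (hVm _).2 (congrArg Subtype.val hw), rfl⟩
    · rintro ⟨x, hx, rfl⟩
      have hGx : G x = -x := (hVm _).1 hx
      let w : W := ⟨x, x.2, by simp [hGx]⟩
      have hw : GW w = -w := Subtype.ext hGx
      change Gred (e w) + e w = 0
      rw [hGred, hw, map_neg, neg_add_cancel]
  have hinv : ∀ u, Gred (Gred u) = u := fun u => by
    obtain ⟨w, rfl⟩ := e.surjective u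
    rw [hGred, hGred]
    exact congrArg e (Subtype.ext (hGG w))
  refine ⟨?_, ?_, ?_, ?_, Gred, ?_, ?_, ?_, hker, hker'⟩
  · rw [eq_top_iff, ← hker, ← hker']
    intro u _
    refine Submodule.mem_sup.2 ⟨(1 / 2 : ℝ) • (u + Gred u), ?_, (1 / 2 : ℝ) • (u - Gred u), ?_, ?_⟩
    · rw [LinearMap.mem_ker, LinearMap.sub_apply, LinearMap.id_apply, map_smul, map_add, hinv]
      module
    · rw [LinearMap.mem_ker, LinearMap.add_apply, LinearMap.id_apply, map_smul, map_sub, hinv]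
      module
    · module
  · rw [eq_bot_iff, ← hker, ← hker']
    rintro u ⟨h₁, h₂⟩
    have h₁ : Gred u = u := sub_eq_zero.1 h₁
    have h₂ : Gred u + u = 0 := h₂
    rw [h₁, ← two_smul ℝ u] at h₂
    exact (smul_eq_zero.1 h₂).resolve_left two_ne_zero
  · intro x hx hne
    have h := hpos x fun h => hne (by rw [show x = 0 from Subtype.ext h, map_zero])
    rw [(hVp _).1 hx] at h
    rwa [hBred]
  · intro x hx hne
    have h := hpos x fun h => hne (by rw [show x = 0 from Subtype.ext h, map_zero])
    rw [(hVm _).1 hx, map_neg, LinearMap.neg_apply] at h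
    rw [hBred]
    linarith
  · intro u v
    obtain ⟨w, rfl⟩ := e.surjective u
    obtain ⟨w', rfl⟩ := e.surjective v
    rw [hGred, hGred, hBe, hBe]
    exact horth w w'
  · intro u v
    obtain ⟨w, rfl⟩ := e.surjective u
    obtain ⟨w', rfl⟩ := e.surjective v
    rw [hGred, hGred, hBe, hBe]
    exact hsa w w'
  · intro u hu
    obtain ⟨w, rfl⟩ := e.surjective u
    rw [hGred, hBe]
    exact hpos w fun h => hu (by rw [show w = 0 from Subtype.ext h, map_zero])
end

section
/- Let V be a finite-dimensional real vector space, B a nondegenerate symmetric bilinear form on V, G a generalized metric on (V,B) with +1-eigenspace V₊, and K ⊆ V an isotropic subspace. Let I : V₊ → V₊ be a linear map with I² = −id and B(Iu,Iv) = B(u,v) for all u,v ∈ V₊, and assume I(V₊ ∩ K⊥) = V₊ ∩ K⊥. Let q : K⊥ → K⊥/K be the quotient map and B^red the induced symmetric bilinear form on K⊥/K. Then q is injective on V₊ ∩ K⊥, and there is a unique linear map I^red : q(V₊ ∩ K⊥) → q(V₊ ∩ K⊥) with I^red(q x) = q(I x) for all x ∈ V₊ ∩ K⊥; moreover (I^red)²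 = −id and B^red(I^red u, I^red v) = B^red(u,v) for all u,v ∈ q(V₊ ∩ K⊥). -/
/-- A linear endomorphism of a submodule on which `f` is injective descends uniquely to
the image of that submodule under `f`. -/
theorem existsUnique_descend_map {M N : Type*} [AddCommGroup M] [Module ℝ M]
    [AddCommGroup N] [Module ℝ N] (f : M →ₗ[ℝ] N) (S : Submodule ℝ M)
    (hf : ∀ x ∈ S, ∀ y ∈ S, f x = f y → x = y) (J : S →ₗ[ℝ] S) :
    ∃! T : S.map f →ₗ[ℝ] S.map f,
      ∀ (x : M) (hx : x ∈ S), (T ⟨f x, Submodule.mem_map_of_mem hx⟩ : N) = f (J ⟨x, hx⟩) := by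
  have hinj : Function.Injective (f.submoduleMap S) := fun x y h =>
    Subtype.ext (hf x x.2 y y.2 (congrArg Subtype.val h))
  let e := LinearEquiv.ofBijective (f.submoduleMap S) ⟨hinj, f.submoduleMap_surjective S⟩
  refine ⟨e.toLinearMap ∘ₗ J ∘ₗ e.symm.toLinearMap, fun x hx => ?_, fun T hT => ?_⟩
  · have h : e.symm ⟨f x, Submodule.mem_map_of_mem hx⟩ = ⟨x, hx⟩ :=
      (LinearEquiv.symm_apply_eq e).2 rfl
    change (e (J (e.symm ⟨f x, _⟩)) : N) = _
    rw [h]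
    rfl
  · ext s
    obtain ⟨x, rfl⟩ := e.surjective s
    have h : (T (e x) : N) = f (J x) := hT x x.2
    simp only [LinearMap.comp_apply, LinearEquiv.coe_coe, e.symm_apply_apply]
    exact h

/-- A vector fixed by a generalized metric that is null for `B` vanishes. -/
theorem eq_zero_of_fixed_of_null {V : Type*} [AddCommGroup V] [Module ℝ V]
    {B : LinearMap.BilinForm ℝ V} {G : V →ₗ[ℝ] V} (hpos : ∀ x : V, x ≠ 0 → 0 < B (G x) x)
    {z : V} (hz : G z = z) (hnull : B z z = 0) : z = 0 := by
  by_contra hne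
  have h := hpos z hne
  rw [hz, hnull] at h
  exact h.false

/-- Reduction of the complex structure of a strong KT structure: if `I` is a
`B`-orthogonal complex structure on `V₊` with `I(V₊ ∩ K⊥) = V₊ ∩ K⊥`, then the quotient
map `q : K⊥ → K⊥/K` is injective on `V₊ ∩ K⊥` and `I` descends to a unique linear map
`I^red` on `q(V₊ ∩ K⊥)` with `I^red (q x) = q (I x)`, which squares to `−id` and is
orthogonal for `B^red`. -/
theorem complex_structure_reduction
    (V : Type*) [AddCommGroup V] [Module ℝ V] [FiniteDimensional ℝ V]
    (B : LinearMap.BilinForm ℝ V)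
    (hnd : ∀ x : V, (∀ y : V, B x y = 0) → x = 0)
    (hsymm : ∀ x y : V, B x y = B y x)
    (G : V →ₗ[ℝ] V)
    (horth : ∀ x y : V, B (G x) (G y) = B x y)
    (hsa : ∀ x y : V, B (G x) y = B x (G y))
    (hpos : ∀ x : V, x ≠ 0 → 0 < B (G x) x)
    (K : Submodule ℝ V)
    (hK : ∀ x ∈ K, ∀ y ∈ K, B x y = 0) :
    ∀ (Vp : Submodule ℝ V), Vp = LinearMap.ker (G - LinearMap.id) →
    ∀ (Kp : Submodule ℝ V), Kp = orthComp B K →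
    ∀ (K' : Submodule ℝ Kp), K' = K.comap Kp.subtype →
    ∀ (I : Vp →ₗ[ℝ] Vp),
      (∀ v : Vp, I (I v) = -v) →
      (∀ u v : Vp, B (I u : V) (I v : V) = B (u : V) (v : V)) →
      -- I preserves V₊ ∩ K⊥ ...
      ∀ (hinv : ∀ v : Vp, (v : V) ∈ Kp → ((I v : Vp) : V) ∈ Kp),
      -- ... and maps it onto itself
      (∀ v : Vp, (v : V) ∈ Kp → ∃ u : Vp, (u : V) ∈ Kp ∧ I u = v) →
      ∀ Bred : LinearMap.BilinForm ℝ (Kp ⧸ K'),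
        (∀ x y : Kp, Bred (K'.mkQ x) (K'.mkQ y) = B (x : V) (y : V)) →
        -- q is injective on V₊ ∩ K⊥
        (∀ x y : Kp, (x : V) ∈ Vp → (y : V) ∈ Vp → K'.mkQ x = K'.mkQ y → x = y) ∧
        -- there is a unique induced map I^red on S = q(V₊ ∩ K⊥) with I^red(q x) = q(I x)
        (∃! Ired : (Submodule.map K'.mkQ (Vp.comap Kp.subtype)) →ₗ[ℝ]
            (Submodule.map K'.mkQ (Vp.comap Kp.subtype)),
          ∀ (x : Kp) (hx : (x : V) ∈ Vp),
            (Ired ⟨K'.mkQ x, Submodule.mem_map_of_mem hx⟩ : Kp ⧸ K')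
              = K'.mkQ ⟨((I ⟨(x : V), hx⟩ : Vp) : V), hinv ⟨(x : V), hx⟩ x.2⟩) ∧
        -- any such I^red squares to −id and is B^red-orthogonal
        (∀ Ired : (Submodule.map K'.mkQ (Vp.comap Kp.subtype)) →ₗ[ℝ]
            (Submodule.map K'.mkQ (Vp.comap Kp.subtype)),
          (∀ (x : Kp) (hx : (x : V) ∈ Vp),
            (Ired ⟨K'.mkQ x, Submodule.mem_map_of_mem hx⟩ : Kp ⧸ K')
              = K'.mkQ ⟨((I ⟨(x : V), hx⟩ : Vp) : V), hinv ⟨(x : V), hx⟩ x.2⟩) →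
          (∀ s, Ired (Ired s) = -s) ∧
          (∀ u v, Bred (Ired u : Kp ⧸ K') (Ired v : Kp ⧸ K')
              = Bred (u : Kp ⧸ K') (v : Kp ⧸ K'))) := by
  intro Vp hVp Kp _ K' hK' I hI hIorth hinv _ Bred hBred
  have hinj : ∀ x y : Kp, (x : V) ∈ Vp → (y : V) ∈ Vp → K'.mkQ x = K'.mkQ y → x = y := by
    intro x y hx hy hxy
    have hmem : (x : V) - y ∈ K := by
      have h := (Submodule.Quotient.eq K').1 hxy
      rwa [hK'] at h
    have hfix : G ((x : V) - y) = x - y := by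
      have h := Vp.sub_mem hx hy
      rw [hVp, LinearMap.mem_ker] at h
      exact sub_eq_zero.1 h
    exact Subtype.ext (sub_eq_zero.1
      (eq_zero_of_fixed_of_null hpos hfix (hK _ hmem _ hmem)))
  refine ⟨hinj, ?_, fun Ired hIred => ⟨?_, ?_⟩⟩
  · let J : Vp.comap Kp.subtype →ₗ[ℝ] Vp.comap Kp.subtype :=
      { toFun := fun x => ⟨⟨I ⟨(x : Kp), x.2⟩, hinv ⟨(x : Kp), x.2⟩ x.1.2⟩,
          (I ⟨(x : Kp), x.2⟩).2⟩
        map_add' := fun x y => Subtype.ext (Subtype.ext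
          (congrArg Vp.subtype (I.map_add ⟨(x : Kp), x.2⟩ ⟨(y : Kp), y.2⟩)))
        map_smul' := fun c x => Subtype.ext (Subtype.ext
          (congrArg Vp.subtype (I.map_smul c ⟨(x : Kp), x.2⟩))) }
    exact existsUnique_descend_map K'.mkQ (Vp.comap Kp.subtype)
      (fun x hx y hy => hinj x y hx hy) J
  · rintro ⟨_, x, hx, rfl⟩
    let y : Kp := ⟨I ⟨x, hx⟩, hinv ⟨x, hx⟩ x.2⟩
    have hy : (y : V) ∈ Vp := (I ⟨x, hx⟩).2
    have h : Ired ⟨K'.mkQ x, Submodule.mem_map_of_mem hx⟩ =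
        ⟨K'.mkQ y, Submodule.mem_map_of_mem hy⟩ := Subtype.ext (hIred x hx)
    apply Subtype.ext
    rw [h, hIred y hy]
    exact (congrArg K'.mkQ (Subtype.ext (congrArg Vp.subtype (hI ⟨x, hx⟩)))).trans
      (K'.mkQ.map_neg x)
  · rintro ⟨_, x, hx, rfl⟩ ⟨_, y, hy, rfl⟩
    rw [hIred x hx, hIred y hy, hBred, hBred]
    exact hIorth ⟨x, hx⟩ ⟨y, hy⟩
end

section
/- Let V be a finite-dimensional real vector space, B a nondegenerate symmetric bilinear form on V, and J₁, J₂ : V → V commuting B-orthogonal linear maps with Jᵢ² = −id such that G := −J₁J₂ satisfies B(Gx,x) > 0 for all x ≠ 0. Let K ⊆ V be an isotropic subspace, set K^G := K⊥ ∩ G(K⊥), and assume Jᵢ(K^G) = K^G for i = 1,2. Then G(K^G) = K^G, the restriction of B to K^G is nondegenerate, the quotient map q : K⊥ → K⊥/K restricts to a linear isomorphism K^G → K⊥/K satisfying B^red(q x, q y) = B(x,y), and the restrictions J₁|_{K^G}, J₂|_{K^G} are commuting complex structures on K^G that are orthogonal for B|_{K^G} and satisfy B(−J₁J₂x, x) >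 0 for all nonzero x ∈ K^G. Hence J₁ and J₂ induce, via q, a pair of commuting orthogonal complex structures on (K⊥/K, B^red) whose product times −1 is a generalized metric. -/
/-- A form that is positive on nonzero vectors splits every vector into a component in `K`
and a component orthogonal to `K`. -/
theorem exists_mem_sub_mem_orthComp {V : Type*} [AddCommGroup V] [Module ℝ V]
    [FiniteDimensional ℝ V] (g : LinearMap.BilinForm ℝ V) (hg : ∀ x y, g x y = g y x)
    (hpos : ∀ x, x ≠ 0 → 0 < g x x) (K : Submodule ℝ V) (x : V) :
    ∃ k ∈ K, x - k ∈ orthComp g K := by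
  have href : g.IsRefl := fun a b h => by rw [hg, h]
  have hrestrict : (g.restrict K).Nondegenerate := by
    refine (LinearMap.IsRefl.nondegenerate_iff_separatingLeft ?_).2 fun a ha => ?_
    · intro a b h
      exact href _ _ h
    · by_contra hne
      exact (hpos a (by simpa using hne)).ne' (ha a)
  have hc := LinearMap.BilinForm.isCompl_orthogonal_of_restrict_nondegenerate href hrestrict
  obtain ⟨k, hk, z, hz, rfl⟩ := Submodule.mem_sup.1 (hc.sup_eq_top ▸ Submodule.mem_top : x ∈ _)
  refine ⟨k, hk, fun l hl => ?_⟩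
  rw [add_sub_cancel_left, hg]
  exact hz l hl

/-- Pointwise generalized Kähler reduction (Bursztyn–Cavalcanti–Gualtieri): if the
commuting orthogonal complex structures `J₁, J₂` (with `G = −J₁J₂` a generalized
metric) preserve `K^G = K⊥ ∩ G(K⊥)` for an isotropic `K`, then `G(K^G) = K^G`, `B` is
nondegenerate on `K^G`, the quotient map restricts to an isometry `K^G ≅ K⊥/K`, and
`J₁, J₂` induce commuting orthogonal complex structures on `(K⊥/K, B^red)` whose
product times `−1` is a generalized metric. -/
theorem generalized_kahler_reduction
    (V : Type*) [AddCommGroup V] [Module ℝ V] [FiniteDimensional ℝ V]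
    (B : LinearMap.BilinForm ℝ V)
    (hnd : ∀ x : V, (∀ y : V, B x y = 0) → x = 0)
    (hsymm : ∀ x y : V, B x y = B y x)
    (J₁ J₂ : V →ₗ[ℝ] V)
    (h1 : ∀ x : V, J₁ (J₁ x) = -x) (h2 : ∀ x : V, J₂ (J₂ x) = -x)
    (ho1 : ∀ x y : V, B (J₁ x) (J₁ y) = B x y)
    (ho2 : ∀ x y : V, B (J₂ x) (J₂ y) = B x y)
    (hcomm : ∀ x : V, J₁ (J₂ x) = J₂ (J₁ x))
    (hpos : ∀ x : V, x ≠ 0 → 0 < B (-(J₁ (J₂ x))) x)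
    (K : Submodule ℝ V)
    (hK : ∀ x ∈ K, ∀ y ∈ K, B x y = 0) :
    let G : V →ₗ[ℝ] V := -(J₁ ∘ₗ J₂)
    let Kp := orthComp B K
    let KG := Kp ⊓ Submodule.map G Kp
    let K' := K.comap Kp.subtype
    let q := K'.mkQ
    -- hypothesis: J₁ and J₂ preserve K^G
    Submodule.map J₁ KG = KG → Submodule.map J₂ KG = KG →
    ∀ Bred : LinearMap.BilinForm ℝ (Kp ⧸ K'),
      (∀ x y : Kp, Bred (q x) (q y) = B (x : V) (y : V)) →
      -- G preserves K^G
      Submodule.map G KG = KG ∧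
      -- B is nondegenerate on K^G
      (∀ x ∈ KG, (∀ y ∈ KG, B x y = 0) → x = 0) ∧
      -- q restricts to a linear isomorphism K^G → K⊥/K compatible with the forms
      Function.Bijective (q ∘ₗ Submodule.inclusion (inf_le_left : KG ≤ Kp)) ∧
      (∀ x y : KG, Bred ((q ∘ₗ Submodule.inclusion (inf_le_left : KG ≤ Kp)) x)
          ((q ∘ₗ Submodule.inclusion (inf_le_left : KG ≤ Kp)) y) = B (x : V) (y : V)) ∧
      -- J₁, J₂ restrict to commuting orthogonal positive complex structures on K^G
      (∀ x ∈ KG, J₁ x ∈ KG) ∧ (∀ x ∈ KG, J₂ x ∈ KG) ∧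
      (∀ x ∈ KG, x ≠ 0 → 0 < B (-(J₁ (J₂ x))) x) ∧
      -- hence they induce, via q, a generalized Kähler pair on (K⊥/K, B^red)
      (∃ J₁' J₂' : (Kp ⧸ K') →ₗ[ℝ] (Kp ⧸ K'),
        (∀ x y : Kp, (x : V) ∈ KG → (y : V) = J₁ (x : V) → J₁' (q x) = q y) ∧
        (∀ x y : Kp, (x : V) ∈ KG → (y : V) = J₂ (x : V) → J₂' (q x) = q y) ∧
        (∀ u, J₁' (J₁' u) = -u) ∧ (∀ u, J₂' (J₂' u) = -u) ∧
        (∀ u, J₁' (J₂' u) = J₂' (J₁' u)) ∧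
        (∀ u v, Bred (J₁' u) (J₁' v) = Bred u v) ∧
        (∀ u v, Bred (J₂' u) (J₂' v) = Bred u v) ∧
        (∀ u v, Bred (-(J₁' (J₂' u))) v = Bred u (-(J₁' (J₂' v)))) ∧
        (∀ u, u ≠ 0 → 0 < Bred (-(J₁' (J₂' u))) u)) := by
  intro G Kp KG K' q hJ₁ hJ₂ Bred hBred
  have hG (x : V) : G x = -(J₁ (J₂ x)) := rfl
  have hGG (x : V) : G (G x) = x := by
    simp only [hG, map_neg, neg_neg]
    rw [← hcomm (J₂ x), h2, map_neg, map_neg, h1, neg_neg]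
  have skew₁ (x y : V) : B (J₁ x) y = -B x (J₁ y) := by
    rw [← ho1 x, h1]; simp
  have skew₂ (x y : V) : B (J₂ x) y = -B x (J₂ y) := by
    rw [← ho2 x, h2]; simp
  have hGadj (x y : V) : B (G x) y = B x (G y) := by
    simp only [hG, map_neg, LinearMap.neg_apply]
    rw [skew₁, skew₂, hcomm y, neg_neg]
  have hmem (x : V) : x ∈ KG ↔ x ∈ Kp ∧ G x ∈ Kp := by
    refine and_congr_right fun _ => ⟨?_, fun h => ⟨G x, h, hGG x⟩⟩
    rintro ⟨y, hy, rfl⟩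
    rwa [hGG]
  have hGKG (x : V) (hx : x ∈ KG) : G x ∈ KG := by
    rw [hmem] at hx ⊢
    rw [hGG]
    exact hx.symm
  have hJ₁KG (x : V) (hx : x ∈ KG) : J₁ x ∈ KG := hJ₁ ▸ Submodule.mem_map_of_mem hx
  have hJ₂KG (x : V) (hx : x ∈ KG) : J₂ x ∈ KG := hJ₂ ▸ Submodule.mem_map_of_mem hx
  set f := q ∘ₗ Submodule.inclusion (inf_le_left : KG ≤ Kp)
  have hfq (x : Kp) (hx : (x : V) ∈ KG) : f ⟨x, hx⟩ = q x := rfl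
  have hfB (x y : KG) : Bred (f x) (f y) = B (x : V) (y : V) := hBred _ _
  have hbij : Function.Bijective f := by
    constructor
    · rw [injective_iff_map_eq_zero]
      intro x hx
      have hxK : (x : V) ∈ K := (Submodule.Quotient.mk_eq_zero K').1 hx
      by_contra hne
      exact (hpos x (by simpa using hne)).ne' (((hmem x).1 x.2).2 x hxK)
    · intro u
      obtain ⟨x, rfl⟩ := K'.mkQ_surjective u
      obtain ⟨k, hk, hxk⟩ := exists_mem_sub_mem_orthComp (B ∘ₗ G)
        (fun a b => by
          rw [LinearMap.comp_apply, LinearMap.comp_apply, hGadj, hsymm]) hpos K (x : V)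
      have hkp : k ∈ Kp := hK k hk
      refine ⟨⟨x - k, (hmem _).2 ⟨Kp.sub_mem x.2 hkp, hxk⟩⟩, ?_⟩
      refine (Submodule.Quotient.eq K').2 ?_
      change (x : V) - k - x ∈ K
      simpa using hk
  let e : KG ≃ₗ[ℝ] (Kp ⧸ K') := LinearEquiv.ofBijective f hbij
  have he (x : KG) : e x = f x := rfl
  let J₁' := e.conj (J₁.restrict hJ₁KG)
  let J₂' := e.conj (J₂.restrict hJ₂KG)
  have hJ₁' (x : KG) : J₁' (f x) = f ⟨J₁ x, hJ₁KG x x.2⟩ := by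
    rw [← he, ← he]
    simp only [J₁', LinearEquiv.conj_apply_apply, LinearEquiv.symm_apply_apply]
    rfl
  have hJ₂' (x : KG) : J₂' (f x) = f ⟨J₂ x, hJ₂KG x x.2⟩ := by
    rw [← he, ← he]
    simp only [J₂', LinearEquiv.conj_apply_apply, LinearEquiv.symm_apply_apply]
    rfl
  refine ⟨?_, ?_, hbij, hfB, hJ₁KG, hJ₂KG, fun x _ => hpos x, J₁', J₂', ?_, ?_,
    ?_, ?_, ?_, ?_, ?_, ?_, ?_⟩
  · refine le_antisymm (Submodule.map_le_iff_le_comap.2 hGKG) fun x hx => ?_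
    exact ⟨G x, hGKG x hx, hGG x⟩
  · intro x hx h
    by_contra hne
    refine (hpos x hne).ne' ?_
    rw [hsymm]
    exact h _ (hGKG x hx)
  · intro x y hx hy
    rw [← hfq x hx, hJ₁', ← hfq y (hy ▸ hJ₁KG x hx)]
    simp only [hy]
  · intro x y hx hy
    rw [← hfq x hx, hJ₂', ← hfq y (hy ▸ hJ₂KG x hx)]
    simp only [hy]
  · refine hbij.surjective.forall.2 fun x => ?_
    rw [hJ₁', hJ₁', ← map_neg]
    exact congrArg f (Subtype.ext (h1 x))
  · refine hbij.surjective.forall.2 fun x => ?_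
    rw [hJ₂', hJ₂', ← map_neg]
    exact congrArg f (Subtype.ext (h2 x))
  · refine hbij.surjective.forall.2 fun x => ?_
    rw [hJ₂', hJ₁', hJ₁', hJ₂']
    exact congrArg f (Subtype.ext (hcomm x))
  · refine hbij.surjective.forall₂.2 fun x y => ?_
    rw [hJ₁', hJ₁', hfB, hfB]
    exact ho1 x y
  · refine hbij.surjective.forall₂.2 fun x y => ?_
    rw [hJ₂', hJ₂', hfB, hfB]
    exact ho2 x y
  · refine hbij.surjective.forall₂.2 fun x y => ?_
    rw [hJ₂', hJ₁', hJ₂', hJ₁', ← map_neg f, ← map_neg f, hfB, hfB]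
    exact hGadj x y
  · refine hbij.surjective.forall.2 fun x hx => ?_
    rw [hJ₂', hJ₁', ← map_neg f, hfB]
    refine hpos x fun h => hx ?_
    rw [Subtype.ext (a2 := (0 : KG)) h, map_zero]
end

section
/- Let W be a real vector space, n a natural number, and X₁,…,Xₙ ∈ W, ξ₁,…,ξₙ, θ₁,…,θₙ ∈ W* such that θᵢ(Xⱼ) = δᵢⱼ (Kronecker delta) and ξᵢ(Xⱼ) + ξⱼ(Xᵢ) = 0 for all i,j. Define the alternating bilinear form B on W by B(v,w) = Σᵢ (θᵢ(v)ξᵢ(w) − θᵢ(w)ξᵢ(v)) + ½ Σᵢⱼ ξⱼ(Xᵢ)(θᵢ(v)θⱼ(w) − θᵢ(w)θⱼ(v)). Then for every k and every w ∈ W, B(X_k, w) = ξ_k(w); that is, the contraction of B with X_k equals ξ_k. -/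
/-- B-field straightening computation: if `θᵢ(Xⱼ) = δᵢⱼ` and `ξᵢ(Xⱼ) + ξⱼ(Xᵢ) = 0`,
then the alternating form
`B(v,w) = Σᵢ (θᵢ(v)ξᵢ(w) − θᵢ(w)ξᵢ(v)) + ½ Σᵢⱼ ξⱼ(Xᵢ)(θᵢ(v)θⱼ(w) − θᵢ(w)θⱼ(v))`
satisfies `B(X_k, w) = ξ_k(w)` for every `k` and `w`. -/
theorem bfield_straightening
    (W : Type*) [AddCommGroup W] [Module ℝ W]
    (n : ℕ) (X : Fin n → W) (ξ θ : Fin n → Module.Dual ℝ W)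
    (hθ : ∀ i j : Fin n, θ i (X j) = if i = j then 1 else 0)
    (hξ : ∀ i j : Fin n, ξ i (X j) + ξ j (X i) = 0) :
    ∀ (k : Fin n) (w : W),
      (∑ i, (θ i (X k) * ξ i w - θ i w * ξ i (X k)))
        + (1 / 2 : ℝ) * ∑ i, ∑ j,
            ξ j (X i) * (θ i (X k) * θ j w - θ i w * θ j (X k))
      = ξ k w := by
  intro k w
  have hk (i : Fin n) : ξ k (X i) = -ξ i (X k) := eq_neg_of_add_eq_zero_left (hξ k i)
  simp only [hθ, mul_sub, Finset.sum_sub_distrib, ite_mul, mul_ite, one_mul, zero_mul,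
    mul_one, mul_zero, Finset.sum_ite_eq', Finset.mem_univ, if_true,
    Finset.sum_ite_irrel, Finset.sum_const_zero, hk, neg_mul, Finset.sum_neg_distrib]
  simp only [mul_comm (θ _ w)]
  ring
end
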